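/- arXiv:2103.06483 — 2 statements merged into one kernel-verified Lean document; each statement's English description precedes it below -/
import Mathlib

section
/- Let P₀ and P_j (j ∈ ℕ) be Markov kernels on ℝ^d. Assume: (i) each P_j admits a unique invariant Borel probability measure μ_j, and P₀ admits a unique invariant Borel probability measure μ₀; (ii) the family {μ_j} is tight; (iii) P₀ is Feller; (iv) T_j converges strongly to T₀, i.e., for every bounded continuous f : ℝ^d → ℝ, sup_{s ∈ ℝ^d} |∫ f(t) P_j(s, dt) − ∫ f(t) P₀(s, dt)| → 0 as j → ∞. Then μ_j converges weakly to μ₀, i.e., ∫ f dμ_j → ∫ f dμ₀ for every bounded continuous f : ℝ^d → ℝ. -/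
open MeasureTheory Filter ProbabilityTheory BoundedContinuousFunction

section MarkovKernel

variable {E : Type*} [TopologicalSpace E] [MeasurableSpace E] [BorelSpace E]

/-- The integral of a bounded continuous function against a probability measure is bounded by
the norm of the function. -/
lemma abs_integral_boundedContinuousFunction_le (μ : Measure E) [IsProbabilityMeasure μ]
    (f : E →ᵇ ℝ) : |∫ x, f x ∂μ| ≤ ‖f‖ := by
  simpa using f.norm_integral_le_norm μ

/-- The Markov operator of a Feller kernel, acting on bounded continuous functions. -/
noncomputable def fellerOperator (κ : Kernel E E) [IsMarkovKernel κ]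
    (hκ : ∀ f : E →ᵇ ℝ, Continuous fun s => ∫ t, f t ∂(κ s)) (f : E →ᵇ ℝ) : E →ᵇ ℝ :=
  BoundedContinuousFunction.ofNormedAddCommGroup (fun s => ∫ t, f t ∂(κ s)) (hκ f) ‖f‖
    fun s => abs_integral_boundedContinuousFunction_le (κ s) f

/-- Integrating against `μ.bind κ` is integrating iteratively. -/
lemma integral_bind_boundedContinuousFunction (μ : Measure E) [IsProbabilityMeasure μ]
    (κ : Kernel E E) [IsMarkovKernel κ] (f : E →ᵇ ℝ) :
    ∫ x, f x ∂(μ.bind κ) = ∫ s, ∫ t, f t ∂(κ s) ∂μ := by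
  simpa [Kernel.comp_apply] using
    Kernel.integral_comp (η := κ) (κ := Kernel.const Unit μ) (a := ()) (f.integrable _)

lemma integrable_integral_boundedContinuousFunction (μ : Measure E) [IsProbabilityMeasure μ]
    (κ : Kernel E E) [IsMarkovKernel κ] (f : E →ᵇ ℝ) :
    Integrable (fun s => ∫ t, f t ∂(κ s)) μ :=
  .of_bound f.continuous.stronglyMeasurable.integral_kernel.aestronglyMeasurable ‖f‖
    (.of_forall fun s => abs_integral_boundedContinuousFunction_le (κ s) f)

/-- The mean difference of two Markov operators is at most its supremum. -/
lemma abs_integral_integral_sub_le_iSup (μ : Measure E) [IsProbabilityMeasure μ]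
    (κ η : Kernel E E) [IsMarkovKernel κ] [IsMarkovKernel η] (f : E →ᵇ ℝ) :
    |(∫ s, ∫ t, f t ∂(κ s) ∂μ) - ∫ s, ∫ t, f t ∂(η s) ∂μ| ≤
      ⨆ s, |(∫ t, f t ∂(κ s)) - ∫ t, f t ∂(η s)| := by
  have hbdd : BddAbove (Set.range fun s => |(∫ t, f t ∂(κ s)) - ∫ t, f t ∂(η s)|) := by
    refine ⟨‖f‖ + ‖f‖, ?_⟩
    rintro _ ⟨s, rfl⟩
    exact (abs_sub _ _).trans (add_le_add (abs_integral_boundedContinuousFunction_le _ f)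
      (abs_integral_boundedContinuousFunction_le _ f))
  rw [← integral_sub (integrable_integral_boundedContinuousFunction μ κ f)
    (integrable_integral_boundedContinuousFunction μ η f)]
  have h := norm_integral_le_of_norm_le_const (μ := μ)
    (f := fun s => (∫ t, f t ∂(κ s)) - ∫ t, f t ∂(η s)) (Eventually.of_forall fun s => le_ciSup hbdd s)
  simpa using h

/-- If Markov operators converge strongly to the operator of a Feller kernel, then a weak limit
of invariant measures is invariant for the limit kernel. -/
lemma bind_eq_of_tendsto_of_strong_operator_convergence [HasOuterApproxClosed E] {ι : Type*}
    {l : Filter ι} [l.NeBot] (κ : Kernel E E) (κs : ι → Kernel E E) [IsMarkovKernel κ]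
    [∀ i, IsMarkovKernel (κs i)] {ν : ProbabilityMeasure E} {νs : ι → ProbabilityMeasure E}
    (hinv : ∀ i, (νs i : Measure E).bind (κs i) = νs i)
    (hκ : ∀ f : E →ᵇ ℝ, Continuous fun s => ∫ t, f t ∂(κ s))
    (hstrong : ∀ f : E →ᵇ ℝ,
      Tendsto (fun i => ⨆ s, |(∫ t, f t ∂(κs i s)) - ∫ t, f t ∂(κ s)|) l (nhds 0))
    (hν : Tendsto νs l (nhds ν)) :
    (ν : Measure E).bind κ = ν := by
  rw [ProbabilityMeasure.tendsto_iff_forall_integral_tendsto] at hν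
  refine ext_of_forall_integral_eq_of_IsFiniteMeasure fun f => ?_
  rw [integral_bind_boundedContinuousFunction]
  have hlim : Tendsto (fun i => ∫ s, ∫ t, f t ∂(κ s) ∂(νs i : Measure E)) l
      (nhds (∫ s, ∫ t, f t ∂(κ s) ∂(ν : Measure E))) := hν (fellerOperator κ hκ f)
  have hdiff : Tendsto (fun i => (∫ s, f s ∂(νs i : Measure E)) -
      ∫ s, ∫ t, f t ∂(κ s) ∂(νs i : Measure E)) l (nhds 0) := by
    refine squeeze_zero_norm (fun i => ?_) (hstrong f)
    have h := abs_integral_integral_sub_le_iSup (νs i : Measure E) (κs i) κ f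
    rwa [← integral_bind_boundedContinuousFunction, hinv i] at h
  exact (sub_eq_zero.mp (tendsto_nhds_unique ((hν f).sub hlim) hdiff)).symm

end MarkovKernel


/-- Convergence of invariant measures: if each Markov kernel `P_j` on `ℝ^d` has a
unique invariant probability measure `μ_j`, `P₀` has a unique invariant probability
measure `μ₀`, the family `{μ_j}` is tight, `P₀` is Feller, and the Markov operators
`T_j` converge strongly to `T₀`, then `μ_j` converges weakly to `μ₀`. -/
theorem invariant_measures_tendsto_of_strong_operator_convergence
    (d : ℕ) (P0 : Kernel (Fin d → ℝ) (Fin d → ℝ)) (Pj : ℕ → Kernel (Fin d → ℝ) (Fin d → ℝ))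
    [IsMarkovKernel P0] [∀ j, IsMarkovKernel (Pj j)]
    (μ0 : Measure (Fin d → ℝ)) (μj : ℕ → Measure (Fin d → ℝ))
    [IsProbabilityMeasure μ0] [∀ j, IsProbabilityMeasure (μj j)]
    -- (i) invariance and uniqueness of the invariant probability measures
    (hinv0 : μ0.bind (fun s => P0 s) = μ0)
    (huniq0 : ∀ ν : Measure (Fin d → ℝ), IsProbabilityMeasure ν →
      ν.bind (fun s => P0 s) = ν → ν = μ0)
    (hinvj : ∀ j, (μj j).bind (fun s => Pj j s) = μj j)
    (huniqj : ∀ j, ∀ ν : Measure (Fin d → ℝ), IsProbabilityMeasure ν →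
      ν.bind (fun s => Pj j s) = ν → ν = μj j)
    -- (ii) tightness of the family {μ_j}
    (htight : ∀ ε : ℝ, 0 < ε → ∃ K : Set (Fin d → ℝ), IsCompact K ∧
      ∀ j, 1 - ENNReal.ofReal ε ≤ μj j K)
    -- (iii) P₀ is Feller
    (hfeller : ∀ f : (Fin d → ℝ) →ᵇ ℝ, Continuous fun s => ∫ t, f t ∂(P0 s))
    -- (iv) strong convergence of the Markov operators T_j to T₀
    (hstrong : ∀ f : (Fin d → ℝ) →ᵇ ℝ,
      Tendsto (fun j => ⨆ s : (Fin d → ℝ), |(∫ t, f t ∂(Pj j s)) - ∫ t, f t ∂(P0 s)|)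
        atTop (nhds 0)) :
    ∀ f : (Fin d → ℝ) →ᵇ ℝ,
      Tendsto (fun j => ∫ s, f s ∂(μj j)) atTop (nhds (∫ s, f s ∂μ0)) := by
  let νs : ℕ → ProbabilityMeasure (Fin d → ℝ) := fun j => ⟨μj j, inferInstance⟩
  have htight' : IsTightMeasureSet
      {((ρ : ProbabilityMeasure (Fin d → ℝ)) : Measure (Fin d → ℝ)) | ρ ∈ Set.range νs} := by
    rw [isTightMeasureSet_iff_exists_isCompact_measure_compl_le]
    intro ε hε
    obtain ⟨δ, hδ, hδε⟩ := ENNReal.lt_iff_exists_nnreal_btwn.mp hε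
    obtain ⟨K, hK, hKμ⟩ := htight δ (by exact_mod_cast hδ)
    refine ⟨K, hK, ?_⟩
    rintro _ ⟨_, ⟨j, rfl⟩, rfl⟩
    change μj j Kᶜ ≤ ε
    rw [prob_compl_eq_one_sub hK.measurableSet]
    refine le_trans ?_ hδε.le
    have h := hKμ j
    rw [ENNReal.ofReal_coe_nnreal, tsub_le_iff_right] at h
    exact tsub_le_iff_left.mpr h
  have hlim : Tendsto νs atTop (nhds ⟨μ0, inferInstance⟩) := by
    refine (tendsto_iff_ultrafilter _ _ _).mpr fun U hU => ?_
    obtain ⟨ν, -, hν⟩ := (isCompact_closure_of_isTightMeasureSet htight').ultrafilter_le_nhds'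
      (U.map νs) (mem_of_superset (Ultrafilter.mem_map.mpr (univ_mem' Set.mem_range_self))
        subset_closure)
    have hinv := bind_eq_of_tendsto_of_strong_operator_convergence P0 Pj (l := (U : Filter ℕ))
      (νs := νs) hinvj hfeller (fun f => (hstrong f).mono_left hU) hν
    have hν0 : ν = ⟨μ0, inferInstance⟩ := Subtype.ext (huniq0 ν inferInstance hinv)
    exact hν0 ▸ hν
  exact ProbabilityMeasure.tendsto_iff_forall_integral_tendsto.mp hlim
end

section
/- Let P₀ and P_j (j ∈ ℕ) be Markov kernels on ℝ^d. Assume: (i) each μ_j is an invariant Borel probability measure for P_j; (ii) μ_j converges weakly to a Borel probability measure μ̂; (iii) P₀ is Feller; (iv) for every bounded continuous f : ℝ^d → ℝ, sup_{s ∈ ℝ^d} |∫ f(t) P_j(s, dt) − ∫ f(t) P₀(s, dt)| → 0 as j → ∞. Then μ̂ is invariant for P₀, i.e., ∫ f dμ̂ = ∫∫ f(t) P₀(s, dt) dμ̂(s) for every bounded continuous f : ℝ^d → ℝ. -/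
open MeasureTheory Filter ProbabilityTheory BoundedContinuousFunction

/-- The integral of a bounded continuous function against a Markov kernel is bounded by its norm. -/
theorem abs_integral_kernel_le_norm {X : Type*} [TopologicalSpace X] [MeasurableSpace X]
    [OpensMeasurableSpace X] (κ : Kernel X X) [IsMarkovKernel κ] (f : X →ᵇ ℝ) (s : X) :
    |∫ t, f t ∂(κ s)| ≤ ‖f‖ := by
  simpa using f.norm_integral_le_norm (κ s)

/-- The averages of a bounded continuous function under a Markov kernel are integrable against
every finite measure. -/
theorem integrable_integral_kernel {X : Type*} [TopologicalSpace X] [MeasurableSpace X]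
    [OpensMeasurableSpace X] (κ : Kernel X X) [IsMarkovKernel κ] (μ : Measure X)
    [IsFiniteMeasure μ] (f : X →ᵇ ℝ) :
    Integrable (fun s => ∫ t, f t ∂(κ s)) μ :=
  Integrable.of_bound
    (f.continuous.measurable.stronglyMeasurable.integral_kernel (κ := κ)).aestronglyMeasurable
    ‖f‖ (.of_forall (abs_integral_kernel_le_norm κ f))

/-- Under a probability measure, the averages of two Markov kernels differ in mean by at most
their uniform distance. -/
theorem abs_integral_integral_kernel_sub_le {X : Type*} [TopologicalSpace X] [MeasurableSpace X]
    [OpensMeasurableSpace X] (κ η : Kernel X X) [IsMarkovKernel κ] [IsMarkovKernel η]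
    (μ : Measure X) [IsProbabilityMeasure μ] (f : X →ᵇ ℝ) :
    |(∫ s, ∫ t, f t ∂(κ s) ∂μ) - ∫ s, ∫ t, f t ∂(η s) ∂μ| ≤
      ⨆ s, |(∫ t, f t ∂(κ s)) - ∫ t, f t ∂(η s)| := by
  have hbdd : BddAbove (Set.range fun s => |(∫ t, f t ∂(κ s)) - ∫ t, f t ∂(η s)|) := by
    refine ⟨‖f‖ + ‖f‖, ?_⟩
    rintro _ ⟨s, rfl⟩
    exact (abs_sub _ _).trans
      (add_le_add (abs_integral_kernel_le_norm κ f s) (abs_integral_kernel_le_norm η f s))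
  rw [← integral_sub (integrable_integral_kernel κ μ f) (integrable_integral_kernel η μ f)]
  have h := norm_integral_le_of_norm_le_const (μ := μ)
    (f := fun s => (∫ t, f t ∂(κ s)) - ∫ t, f t ∂(η s)) (.of_forall fun s => le_ciSup hbdd s)
  simpa using h

/-- If `μ_j` are invariant probability measures for Markov kernels `P_j` on `ℝ^d` that
converge weakly to `μ̂`, `P₀` is Feller, and the Markov operators of `P_j` converge
strongly (uniformly in the state) to that of `P₀`, then `μ̂` is invariant for `P₀`. -/
theorem weak_limit_of_invariant_measures_is_invariant
    (d : ℕ) (P0 : Kernel (Fin d → ℝ) (Fin d → ℝ)) (Pj : ℕ → Kernel (Fin d → ℝ) (Fin d → ℝ))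
    [IsMarkovKernel P0] [∀ j, IsMarkovKernel (Pj j)]
    (μj : ℕ → Measure (Fin d → ℝ)) (μhat : Measure (Fin d → ℝ))
    [∀ j, IsProbabilityMeasure (μj j)] [IsProbabilityMeasure μhat]
    -- (i) each μ_j is invariant for P_j
    (hinvj : ∀ j, (μj j).bind (fun s => Pj j s) = μj j)
    -- (ii) μ_j converges weakly to μ̂
    (hweak : ∀ f : (Fin d → ℝ) →ᵇ ℝ,
      Tendsto (fun j => ∫ s, f s ∂(μj j)) atTop (nhds (∫ s, f s ∂μhat)))
    -- (iii) P₀ is Feller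
    (hfeller : ∀ f : (Fin d → ℝ) →ᵇ ℝ, Continuous fun s => ∫ t, f t ∂(P0 s))
    -- (iv) strong convergence of the Markov operators
    (hstrong : ∀ f : (Fin d → ℝ) →ᵇ ℝ,
      Tendsto (fun j => ⨆ s : (Fin d → ℝ), |(∫ t, f t ∂(Pj j s)) - ∫ t, f t ∂(P0 s)|)
        atTop (nhds 0)) :
    ∀ f : (Fin d → ℝ) →ᵇ ℝ, ∫ s, f s ∂μhat = ∫ s, ∫ t, f t ∂(P0 s) ∂μhat := by
  intro f
  let g : (Fin d → ℝ) →ᵇ ℝ := BoundedContinuousFunction.ofNormedAddCommGroup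
    (fun s => ∫ t, f t ∂(P0 s)) (hfeller f) ‖f‖ (abs_integral_kernel_le_norm P0 f)
  have hinv : ∀ j, ∫ s, f s ∂(μj j) = ∫ s, ∫ t, f t ∂(Pj j s) ∂(μj j) := fun j => by
    have hcomp : (Pj j ∘ₖ Kernel.const Unit (μj j)) () = μj j :=
      Measure.comp_eq_comp_const_apply.symm.trans (hinvj j)
    have h := Kernel.integral_comp (η := Pj j) (κ := Kernel.const Unit (μj j)) (a := ())
      (hcomp.symm ▸ f.integrable (μj j))
    rwa [hcomp, Kernel.const_apply] at h
  have hdiff : Tendsto (fun j => (∫ s, f s ∂(μj j)) - ∫ s, g s ∂(μj j)) atTop (nhds 0) := by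
    refine squeeze_zero_norm (fun j => ?_) (hstrong f)
    rw [hinv j]
    exact abs_integral_integral_kernel_sub_le (Pj j) P0 (μj j) f
  exact sub_eq_zero.mp (tendsto_nhds_unique ((hweak f).sub (hweak g)) hdiff)
end
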